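/- arXiv:2303.15347 — 6 statements merged into one kernel-verified Lean document; each statement's English description precedes it below -/
import Mathlib

section
/- Let Γ be a subgroup of ℚ/ℤ which is not finitely generated. Then there exist sequences γ : ℕ → ℚ/ℤ and k : ℕ → ℕ such that: every γ_j lies in Γ; k_j ≥ 2 for all j; the additive order of γ_j equals the product k₀·k₁⋯k_j for every j; (k_{j+1}) • γ_{j+1} = γ_j for every j; and every element of Γ is an integer multiple of γ_j for some j (so the cyclic subgroups generated by the γ_j form an increasing sequence whose union is Γ). -/
namespace AddSubgroup

theorem exists_mem_zmultiples_pair_rat_quotient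
    (a b : ℚ ⧸ zmultiples (1 : ℚ)) :
    ∃ c, a ∈ zmultiples c ∧ b ∈ zmultiples c := by
  obtain ⟨p, rfl⟩ := QuotientAddGroup.mk_surjective a
  obtain ⟨q, rfl⟩ := QuotientAddGroup.mk_surjective b
  have hp : (p.den : ℚ) ≠ 0 := by exact_mod_cast p.den_nz
  have hq : (q.den : ℚ) ≠ 0 := by exact_mod_cast q.den_nz
  refine ⟨((1 / (p.den * q.den) : ℚ) : ℚ ⧸ zmultiples (1 : ℚ)),
    mem_zmultiples_iff.2 ⟨p.num * q.den, ?_⟩, mem_zmultiples_iff.2 ⟨q.num * p.den, ?_⟩⟩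
  · rw [← QuotientAddGroup.mk_zsmul]
    congr 1
    conv_rhs => rw [← Rat.num_div_den p]
    simp only [zsmul_eq_mul]
    push_cast
    field_simp
  · rw [← QuotientAddGroup.mk_zsmul]
    congr 1
    conv_rhs => rw [← Rat.num_div_den q]
    simp only [zsmul_eq_mul]
    push_cast
    field_simp

/-- Any two elements of a subgroup of `ℚ/ℤ` lie in a common cyclic subgroup of it. -/
theorem exists_mem_mem_zmultiples_pair (Γ : AddSubgroup (ℚ ⧸ zmultiples (1 : ℚ)))
    {a b : ℚ ⧸ zmultiples (1 : ℚ)} (ha : a ∈ Γ) (hb : b ∈ Γ) :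
    ∃ c ∈ Γ, a ∈ zmultiples c ∧ b ∈ zmultiples c := by
  obtain ⟨d, had, hbd⟩ := exists_mem_zmultiples_pair_rat_quotient a b
  have hcyc : IsAddCyclic (Γ ⊓ zmultiples d : AddSubgroup _) :=
    isAddCyclic_of_le inf_le_right
  obtain ⟨c, hc⟩ := (AddSubgroup.isAddCyclic_iff_exists_zmultiples_eq_top _).1 hcyc
  have hcΓ : c ∈ Γ := (hc ▸ mem_zmultiples c : c ∈ Γ ⊓ zmultiples d).1
  refine ⟨c, hcΓ, ?_, ?_⟩
  · rw [hc]; exact ⟨ha, had⟩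
  · rw [hc]; exact ⟨hb, hbd⟩

end AddSubgroup

theorem addOrderOf_rat_quotient_pos (a : ℚ ⧸ AddSubgroup.zmultiples (1 : ℚ)) :
    0 < addOrderOf a := by
  obtain ⟨p, rfl⟩ := QuotientAddGroup.mk_surjective a
  refine addOrderOf_pos_iff.2 (isOfFinAddOrder_iff_nsmul_eq_zero.2 ⟨p.den, p.den_pos, ?_⟩)
  rw [← QuotientAddGroup.mk_nsmul, QuotientAddGroup.eq_zero_iff]
  refine AddSubgroup.mem_zmultiples_iff.2 ⟨p.num, ?_⟩
  simp

/-- In a finite cyclic group, every element is a natural multiple of some generator, the factor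
being the index of the subgroup it generates. -/
theorem exists_nsmul_eq_of_mem_zmultiples {A : Type*} [AddCommGroup A] {a g : A}
    (hg : 0 < addOrderOf g) (ha : a ∈ AddSubgroup.zmultiples g) :
    ∃ (g' : A) (k : ℕ), AddSubgroup.zmultiples g' = AddSubgroup.zmultiples g ∧
      k • g' = a ∧ addOrderOf g' = k * addOrderOf a := by
  have hfin : IsOfFinAddOrder g := addOrderOf_pos_iff.1 hg
  obtain ⟨m, rfl⟩ := (hfin.mem_multiples_iff_mem_zmultiples).2 ha
  simp only
  set N := addOrderOf g with hN
  have hK : 0 < N.gcd m := Nat.gcd_pos_of_pos_left _ hg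
  obtain ⟨K, n, m', hK', hcop, hNn, hm⟩ : ∃ K n m' : ℕ, 0 < K ∧ m'.Coprime n ∧
      N = K * n ∧ m = K * m' := by
    refine ⟨N.gcd m, N / N.gcd m, m / N.gcd m, hK, (Nat.coprime_div_gcd_div_gcd hK).symm,
      (Nat.mul_div_cancel' (Nat.gcd_dvd_left _ _)).symm,
      (Nat.mul_div_cancel' (Nat.gcd_dvd_right _ _)).symm⟩
  have hgcd : N.gcd m = K := by
    rw [hNn, hm, Nat.gcd_mul_left, hcop.symm.gcd_eq_one, mul_one]
  have hord : addOrderOf (m • g) = n := by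
    rw [hfin.addOrderOf_nsmul, ← hN, hgcd, hNn, Nat.mul_div_cancel_left _ hK']
  have : NeZero N := ⟨hg.ne'⟩
  obtain ⟨u, hu⟩ := ZMod.unitsMap_surjective (Dvd.intro_left K hNn.symm)
    (ZMod.unitOfCoprime m' hcop)
  have hucop : (u : ZMod N).val.Coprime N := ZMod.val_coe_unit_coprime u
  have hmod : (u : ZMod N).val ≡ m' [MOD n] := by
    rw [← ZMod.natCast_eq_natCast_iff]
    have := congrArg Units.val hu
    simpa [ZMod.unitsMap_def, ZMod.natCast_val] using this
  have hordu : addOrderOf ((u : ZMod N).val • g) = N := by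
    rw [hfin.addOrderOf_nsmul, ← hN, hucop.symm.gcd_eq_one, Nat.div_one]
  refine ⟨(u : ZMod N).val • g, K, ?_, ?_, ?_⟩
  · have : Finite (AddSubgroup.zmultiples g) := by
      rw [← SetLike.coe_sort_coe]; exact hfin.finite_zmultiples
    refine AddSubgroup.eq_of_le_of_card_ge ?_ ?_
    · exact AddSubgroup.zmultiples_le_of_mem (AddSubgroup.nsmul_mem_zmultiples _ _)
    · rw [Nat.card_zmultiples, Nat.card_zmultiples, hordu]
  · rw [smul_smul, nsmul_eq_nsmul_iff_modEq, ← hN]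
    have := hmod.mul_left' K
    rwa [← hNn, ← hm] at this
  · rw [hordu, hord, hNn]

theorem AddSubgroup.exists_nsmul_eq_of_not_fg
    {Γ : AddSubgroup (ℚ ⧸ zmultiples (1 : ℚ))} (hΓ : ¬ Γ.FG)
    {a e : ℚ ⧸ zmultiples (1 : ℚ)} (ha : a ∈ Γ) (he : e ∈ Γ) :
    ∃ b ∈ Γ, ∃ k : ℕ, 2 ≤ k ∧ addOrderOf b = k * addOrderOf a ∧ k • b = a ∧
      e ∈ zmultiples b := by
  obtain ⟨f, hf, hfa⟩ : ∃ f ∈ Γ, f ∉ zmultiples a := by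
    by_contra! h
    refine hΓ ⟨{a}, ?_⟩
    rw [Finset.coe_singleton, ← zmultiples_eq_closure]
    exact le_antisymm (zmultiples_le_of_mem ha) h
  obtain ⟨c, hc, hac, hec⟩ := Γ.exists_mem_mem_zmultiples_pair ha he
  obtain ⟨g, hg, hcg, hfg⟩ := Γ.exists_mem_mem_zmultiples_pair hc hf
  have hle : zmultiples c ≤ zmultiples g := zmultiples_le_of_mem hcg
  obtain ⟨b, k, hb, hkb, hord⟩ :=
    exists_nsmul_eq_of_mem_zmultiples (addOrderOf_rat_quotient_pos g) (hle hac)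
  refine ⟨b, zmultiples_le_of_mem hg (hb ▸ mem_zmultiples b), k, ?_, hord, hkb,
    hb ▸ hle hec⟩
  have h0 : k ≠ 0 := by
    rintro rfl
    exact (addOrderOf_rat_quotient_pos b).ne' (by simpa using hord)
  have h1 : k ≠ 1 := by
    rintro rfl
    rw [one_smul] at hkb
    exact hfa (by rw [← hkb, hb]; exact hfg)
  lia

/-- A non-finitely-generated subgroup `Γ ≤ ℚ/ℤ` admits sequences `γ j ∈ Γ` and `k j ≥ 2`
with `addOrderOf (γ j) = k 0 * ⋯ * k j`, `(k (j+1)) • γ (j+1) = γ j`, and such that every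
element of `Γ` is an integer multiple of some `γ j`. -/
theorem stmt4 (Γ : AddSubgroup (ℚ ⧸ AddSubgroup.zmultiples (1 : ℚ))) (hΓ : ¬ Γ.FG) :
    ∃ (γ : ℕ → ℚ ⧸ AddSubgroup.zmultiples (1 : ℚ)) (k : ℕ → ℕ),
      (∀ j, γ j ∈ Γ) ∧
      (∀ j, 2 ≤ k j) ∧
      (∀ j, addOrderOf (γ j) = ∏ i ∈ Finset.range (j + 1), k i) ∧
      (∀ j, (k (j + 1)) • γ (j + 1) = γ j) ∧
      (∀ x ∈ Γ, ∃ (j : ℕ) (n : ℤ), x = n • γ j) := by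
  have hcount : Countable (ℚ ⧸ AddSubgroup.zmultiples (1 : ℚ)) :=
    QuotientAddGroup.mk_surjective.countable
  obtain ⟨e, he⟩ := exists_surjective_nat Γ
  have hstep : ∀ a x : Γ, ∃ (b : Γ) (k : ℕ), 2 ≤ k ∧
      addOrderOf (b : ℚ ⧸ AddSubgroup.zmultiples (1 : ℚ)) =
        k * addOrderOf (a : ℚ ⧸ AddSubgroup.zmultiples (1 : ℚ)) ∧
      k • (b : ℚ ⧸ AddSubgroup.zmultiples (1 : ℚ)) = a ∧
      (x : ℚ ⧸ AddSubgroup.zmultiples (1 : ℚ)) ∈ AddSubgroup.zmultiples (b : ℚ ⧸ _) := by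
    intro a x
    obtain ⟨b, hb, k, h⟩ := AddSubgroup.exists_nsmul_eq_of_not_fg hΓ a.2 x.2
    exact ⟨⟨b, hb⟩, k, h⟩
  choose next k hk hord hsmul hmem using hstep
  let s : ℕ → Γ := fun j => Nat.rec 0 (fun i a => next a (e i)) j
  refine ⟨fun j => s (j + 1), fun j => k (s j) (e j), fun j => (s (j + 1)).2,
    fun j => hk _ _, fun j => ?_, fun j => hsmul (s (j + 1)) (e (j + 1)), fun x hx => ?_⟩
  · have key : ∀ j : ℕ, addOrderOf (s j).1 =
        ∏ i ∈ Finset.range j, k (s i) (e i) := by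
      intro j
      induction j with
      | zero => simp [s]
      | succ j ih => rw [Finset.prod_range_succ, ← ih, mul_comm]; exact hord _ _
    exact key (j + 1)
  · obtain ⟨j, hj⟩ := he ⟨x, hx⟩
    obtain ⟨n, hn⟩ := AddSubgroup.mem_zmultiples_iff.1 (hmem (s j) (e j))
    refine ⟨j, n, ?_⟩
    rw [hj] at hn
    exact hn.symm.trans (by rw [← hj])
end

section
/- Let γ : ℕ → ℚ/ℤ and k : ℕ → ℕ be sequences such that k_j ≥ 2 for all j, the additive order of γ_j equals k₀·k₁⋯k_j for every j, and (k_{j+1}) • γ_{j+1} = γ_j for every j. Then for every j₀ ∈ ℕ and every element x of the subgroup of ℚ/ℤ generated by {γ_j : j ∈ ℕ}, there exist a unique y ∈ ℚ/ℤ and a unique finitely supported function b : ℕ → ℕ such that: y is an integer multiple of γ_{j₀}; b_i = 0 for all i ≤ j₀; b_i < k_i for all i; and x = y + Σ_i (b_i) • γ_i. -/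
section DivisionTower

variable {A : Type*} [AddCommGroup A] {γ : ℕ → A} {k : ℕ → ℕ}

theorem zmultiples_le_zmultiples_of_nsmul_succ (hrel : ∀ j, k (j + 1) • γ (j + 1) = γ j) :
    Monotone fun j => AddSubgroup.zmultiples (γ j) := by
  refine monotone_nat_of_le_succ fun j => ?_
  rw [AddSubgroup.zmultiples_le, ← hrel j]
  exact AddSubgroup.nsmul_mem_zmultiples _ _

theorem exists_mem_zmultiples_of_mem_closure (hrel : ∀ j, k (j + 1) • γ (j + 1) = γ j) {x : A}
    (hx : x ∈ AddSubgroup.closure (Set.range γ)) : ∃ n, x ∈ AddSubgroup.zmultiples (γ n) := by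
  have hmono := zmultiples_le_zmultiples_of_nsmul_succ hrel
  induction hx using AddSubgroup.closure_induction with
  | mem x hx =>
    obtain ⟨n, rfl⟩ := hx
    exact ⟨n, AddSubgroup.mem_zmultiples _⟩
  | zero => exact ⟨0, zero_mem _⟩
  | add x y _ _ hx hy =>
    obtain ⟨m, hm⟩ := hx
    obtain ⟨n, hn⟩ := hy
    exact ⟨max m n, add_mem (hmono (le_max_left m n) hm) (hmono (le_max_right m n) hn)⟩
  | neg x _ hx =>
    obtain ⟨m, hm⟩ := hx
    exact ⟨m, neg_mem hm⟩

theorem exists_digit_expansion (hk : ∀ j, 0 < k j) (hrel : ∀ j, k (j + 1) • γ (j + 1) = γ j)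
    (j₀ m : ℕ) {x : A} (hx : x ∈ AddSubgroup.zmultiples (γ (j₀ + m))) :
    ∃ y ∈ AddSubgroup.zmultiples (γ j₀), ∃ b : ℕ →₀ ℕ, (∀ i ≤ j₀, b i = 0) ∧
      (∀ i, j₀ + m < i → b i = 0) ∧ (∀ i, b i < k i) ∧ x = y + b.sum fun i n => n • γ i := by
  induction m generalizing x with
  | zero => exact ⟨x, hx, 0, by simp, by simp, by simpa using hk, by simp⟩
  | succ m ih =>
    obtain ⟨z, rfl⟩ := AddSubgroup.mem_zmultiples_iff.mp hx
    have hpos : (0 : ℤ) < k (j₀ + (m + 1)) := by exact_mod_cast hk _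
    obtain ⟨r, hr⟩ := Int.eq_ofNat_of_zero_le (Int.emod_nonneg z hpos.ne')
    have hrk : r < k (j₀ + (m + 1)) := by
      have := Int.emod_lt_of_pos z hpos
      omega
    obtain ⟨y, hy, b, hb0, hbm, hbk, hsum⟩ :=
      ih (AddSubgroup.zsmul_mem_zmultiples (γ (j₀ + m)) (z / k (j₀ + (m + 1))))
    refine ⟨y, hy, b + Finsupp.single (j₀ + (m + 1)) r, ?_, ?_, ?_, ?_⟩
    · intro i hi
      simp [hb0 i hi, Finsupp.single_apply]
      omega
    · intro i hi
      simp [hbm i (by omega), Finsupp.single_apply]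
      omega
    · intro i
      rcases eq_or_ne (j₀ + (m + 1)) i with rfl | hi
      · simpa [hbm (j₀ + (m + 1)) (by omega)] using hrk
      · simpa [Finsupp.single_apply, hi] using hbk i
    · have hz : z • γ (j₀ + (m + 1)) =
          (z / k (j₀ + (m + 1))) • γ (j₀ + m) + r • γ (j₀ + (m + 1)) := by
        conv_lhs => rw [← Int.ediv_mul_add_emod z (k (j₀ + (m + 1))), hr]
        rw [add_smul, mul_smul, natCast_zsmul, natCast_zsmul, ← add_assoc j₀ m 1, hrel]
      rw [hz, Finsupp.sum_add_index' (by simp) (by simp [add_smul]),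
        Finsupp.sum_single_index (by simp), hsum, add_assoc]

theorem digit_eq_of_sub_zsmul_mem (hord : ∀ j, addOrderOf (γ j) = ∏ i ∈ Finset.range (j + 1), k i)
    (hk : ∀ j, 0 < k j) {n a c : ℕ} (ha : a < k (n + 1)) (hc : c < k (n + 1))
    (h : ((a : ℤ) - c) • γ (n + 1) ∈ AddSubgroup.zmultiples (γ n)) : a = c := by
  obtain ⟨z, hz⟩ := AddSubgroup.mem_zmultiples_iff.mp h
  have hzero : ((addOrderOf (γ n) : ℤ) * ((a : ℤ) - c)) • γ (n + 1) = 0 := by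
    rw [mul_zsmul, ← hz, ← mul_zsmul, mul_comm, mul_zsmul, natCast_zsmul,
      addOrderOf_nsmul_eq_zero, zsmul_zero]
  rw [← addOrderOf_dvd_iff_zsmul_eq_zero, hord (n + 1), Finset.prod_range_succ, ← hord n,
    Nat.cast_mul] at hzero
  have hpos : (addOrderOf (γ n) : ℤ) ≠ 0 := by
    rw [hord n]
    exact_mod_cast (Finset.prod_pos fun i _ => hk i).ne'
  have hdvd := Int.dvd_of_mul_dvd_mul_left hpos hzero
  have := Int.eq_zero_of_abs_lt_dvd hdvd (by rw [abs_lt]; omega)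
  omega

theorem digit_expansion_unique (hk : ∀ j, 0 < k j)
    (hord : ∀ j, addOrderOf (γ j) = ∏ i ∈ Finset.range (j + 1), k i)
    (hrel : ∀ j, k (j + 1) • γ (j + 1) = γ j) (j₀ m : ℕ) {y y' : A}
    (hy : y ∈ AddSubgroup.zmultiples (γ j₀)) (hy' : y' ∈ AddSubgroup.zmultiples (γ j₀))
    {b b' : ℕ → ℕ} (hb0 : ∀ i ≤ j₀, b i = 0) (hb0' : ∀ i ≤ j₀, b' i = 0)
    (hbk : ∀ i, b i < k i) (hbk' : ∀ i, b' i < k i)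
    (h : y + ∑ i ∈ Finset.range (j₀ + m + 1), b i • γ i =
      y' + ∑ i ∈ Finset.range (j₀ + m + 1), b' i • γ i) :
    y = y' ∧ ∀ i ≤ j₀ + m, b i = b' i := by
  have hmono := zmultiples_le_zmultiples_of_nsmul_succ hrel
  induction m with
  | zero =>
    have hsum : ∀ c : ℕ → ℕ, (∀ i ≤ j₀, c i = 0) →
        ∑ i ∈ Finset.range (j₀ + 0 + 1), c i • γ i = 0 := fun c hc =>
      Finset.sum_eq_zero fun i hi => by
        rw [hc i (by simpa [Nat.lt_succ_iff] using hi), zero_smul]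
    rw [hsum b hb0, hsum b' hb0', add_zero, add_zero] at h
    exact ⟨h, fun i hi => (hb0 i hi).trans (hb0' i hi).symm⟩
  | succ m ih =>
    have hmem : ∀ w ∈ AddSubgroup.zmultiples (γ j₀), ∀ c : ℕ → ℕ,
        w + ∑ i ∈ Finset.range (j₀ + m + 1), c i • γ i ∈ AddSubgroup.zmultiples (γ (j₀ + m)) :=
      fun w hw c => add_mem (hmono (Nat.le_add_right j₀ m) hw) <| sum_mem fun i hi =>
        nsmul_mem (hmono (Nat.lt_succ_iff.mp (Finset.mem_range.mp hi))
          (AddSubgroup.mem_zmultiples _)) _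
    rw [← add_assoc j₀ m 1, Finset.sum_range_succ, Finset.sum_range_succ _ (j₀ + m + 1),
      ← add_assoc, ← add_assoc] at h
    have htop : b (j₀ + m + 1) = b' (j₀ + m + 1) := by
      refine digit_eq_of_sub_zsmul_mem hord hk (hbk _) (hbk' _) ?_
      have hdiff := sub_mem (hmem y' hy' b') (hmem y hy b)
      convert hdiff using 1
      rw [sub_smul, natCast_zsmul, natCast_zsmul, sub_eq_sub_iff_add_eq_add, add_comm, h]
    rw [htop, add_left_inj] at h
    obtain ⟨hyy, hbb⟩ := ih h
    refine ⟨hyy, fun i hi => ?_⟩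
    rcases Nat.le_succ_iff.mp hi with hi | rfl
    · exact hbb i hi
    · exact htop

end DivisionTower

/-- Splitting of elements of the subgroup generated by the `γ j`: for every `j₀` and
every `x` in the subgroup, there are a unique `y` which is an integer multiple of `γ j₀`
and a unique finitely supported `b` with `b i = 0` for `i ≤ j₀`, `b i < k i`, and
`x = y + Σ_i (b i) • γ i`. -/
theorem stmt6 (γ : ℕ → ℚ ⧸ AddSubgroup.zmultiples (1 : ℚ)) (k : ℕ → ℕ)
    (hk : ∀ j, 2 ≤ k j)
    (hord : ∀ j, addOrderOf (γ j) = ∏ i ∈ Finset.range (j + 1), k i)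
    (hrel : ∀ j, (k (j + 1)) • γ (j + 1) = γ j)
    (j₀ : ℕ) (x : ℚ ⧸ AddSubgroup.zmultiples (1 : ℚ))
    (hx : x ∈ AddSubgroup.closure (Set.range γ)) :
    ∃! p : (ℚ ⧸ AddSubgroup.zmultiples (1 : ℚ)) × (ℕ →₀ ℕ),
      p.1 ∈ AddSubgroup.zmultiples (γ j₀) ∧
      (∀ i ≤ j₀, p.2 i = 0) ∧
      (∀ i, p.2 i < k i) ∧
      x = p.1 + p.2.sum fun i n => n • γ i := by
  have hk0 : ∀ j, 0 < k j := fun j => two_pos.trans_le (hk j)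
  obtain ⟨n, hn⟩ := exists_mem_zmultiples_of_mem_closure hrel hx
  obtain ⟨y, hy, b, hb0, -, hbk, hsum⟩ := exists_digit_expansion hk0 hrel j₀ n
    (zmultiples_le_zmultiples_of_nsmul_succ hrel (Nat.le_add_left n j₀) hn)
  refine ⟨(y, b), ⟨hy, hb0, hbk, hsum⟩, ?_⟩
  rintro ⟨y', b'⟩ ⟨hy', hb0', hbk', hsum'⟩
  dsimp only at hy' hb0' hbk' hsum'
  set m := (b.support ∪ b'.support).sup id
  have hle : ∀ i ∈ b.support ∪ b'.support, i ≤ m := fun i hi => Finset.le_sup (f := id) hi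
  have hb : b.support ⊆ Finset.range (j₀ + m + 1) := fun i hi => by
    have := hle i (Finset.mem_union_left _ hi)
    rw [Finset.mem_range]
    omega
  have hb' : b'.support ⊆ Finset.range (j₀ + m + 1) := fun i hi => by
    have := hle i (Finset.mem_union_right _ hi)
    rw [Finset.mem_range]
    omega
  rw [Finsupp.sum_of_support_subset b hb _ (by simp)] at hsum
  rw [Finsupp.sum_of_support_subset b' hb' _ (by simp)] at hsum'
  obtain ⟨hyy, hbb⟩ := digit_expansion_unique hk0 hord hrel j₀ m hy' hy hb0' hb0 hbk' hbk
    (hsum'.symm.trans hsum)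
  refine Prod.ext hyy (Finsupp.ext fun i => ?_)
  by_cases hi : i ≤ j₀ + m
  · exact hbb i hi
  · have hnot : i ∉ Finset.range (j₀ + m + 1) := by
      rw [Finset.mem_range]
      omega
    exact (Finsupp.notMem_support_iff.mp fun h => hnot (hb' h)).trans
      (Finsupp.notMem_support_iff.mp fun h => hnot (hb h)).symm
end

section
/- Let Y be a set, let m, k be positive integers, and let g : Y → Y be a map such that the m-fold iterate g^m is the identity and, for every 0 < i < m, the iterate g^i has no fixed point. Define T : Y × (ℤ/kℤ) → Y × (ℤ/kℤ) by T(y, a) = (g(y), a+1) if a + 1 = 0 in ℤ/kℤ, and T(y, a) = (y, a+1) otherwise. Then: (i) the k-fold iterate satisfies T^k(y,a) = (g(y), a) for all (y,a); (ii) T^{k·m} is the identity; and (iii) for every 0 < j < k·m, the iterate T^j has no fixed point. In particular, T generates a free action of the cyclic group of order k·m on Y × (ℤ/kℤ) whose k-th power acts as g on each slice. -/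
/-- Each passage of the second coordinate through `0` contributes one application of `g`. -/
theorem twistedGluing_iterate {Y : Type*} {k : ℕ} {g : Y → Y} {T : Y × ZMod k → Y × ZMod k}
    (hT : ∀ y a, T (y, a) = if a + 1 = 0 then (g y, a + 1) else (y, a + 1))
    {c : ℕ} (hc : c < k) (y : Y) (n : ℕ) :
    T^[n] (y, (c : ZMod k)) = (g^[(c + n) / k] y, ((c + n : ℕ) : ZMod k)) := by
  induction n with
  | zero => simp [Nat.div_eq_of_lt hc]
  | succ n ih =>
    have hzero : ((c + n : ℕ) : ZMod k) + 1 = 0 ↔ k ∣ c + n + 1 := by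
      rw [← Nat.cast_add_one, ZMod.natCast_eq_zero_iff]
    rw [Function.iterate_succ_apply', ih, hT, ← add_assoc, Nat.succ_div, Nat.cast_add_one (c + n)]
    simp only [hzero]
    split_ifs
    · rw [Function.iterate_succ_apply']
    · rfl

/-- Iterating the twisted gluing map `k * i` times applies `g^[i]` on each slice. -/
theorem twistedGluing_iterate_mul {Y : Type*} {k : ℕ} (hk : 0 < k) {g : Y → Y}
    {T : Y × ZMod k → Y × ZMod k}
    (hT : ∀ y a, T (y, a) = if a + 1 = 0 then (g y, a + 1) else (y, a + 1))
    (i : ℕ) (p : Y × ZMod k) : T^[k * i] p = (g^[i] p.1, p.2) := by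
  have : NeZero k := ⟨hk.ne'⟩
  obtain ⟨y, a⟩ := p
  have h := twistedGluing_iterate hT (ZMod.val_lt a) y (k * i)
  rw [Nat.add_mul_div_left _ _ hk, Nat.div_eq_of_lt (ZMod.val_lt a), zero_add] at h
  simpa using h


/-- The twisted gluing permutation: if `g : Y → Y` generates a free action of `ℤ/mℤ`
(its `m`-th iterate is the identity and no smaller positive iterate has a fixed point),
then the map `T (y, a) = (g y, a+1)` if `a+1 = 0` and `(y, a+1)` otherwise satisfies
`T^[k] (y,a) = (g y, a)`, `T^[k*m] = id`, and no iterate `T^[j]` with `0 < j < k*m`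
has a fixed point; i.e. `T` generates a free action of the cyclic group of order `k·m`. -/
theorem stmt13 {Y : Type*} (m k : ℕ) (hm : 0 < m) (hk : 0 < k)
    (g : Y → Y) (hgm : g^[m] = id)
    (hfree : ∀ i, 0 < i → i < m → ∀ y, g^[i] y ≠ y)
    (T : Y × ZMod k → Y × ZMod k)
    (hT : ∀ y a, T (y, a) = if a + 1 = 0 then (g y, a + 1) else (y, a + 1)) :
    (∀ p : Y × ZMod k, T^[k] p = (g p.1, p.2)) ∧
    T^[k * m] = id ∧
    (∀ j, 0 < j → j < k * m → ∀ p, T^[j] p ≠ p) := by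
  have : NeZero k := ⟨hk.ne'⟩
  refine ⟨fun p => by simpa using twistedGluing_iterate_mul hk hT 1 p, ?_, ?_⟩
  · funext p
    simp [twistedGluing_iterate_mul hk hT, hgm]
  · rintro j hj hjkm ⟨y, a⟩ hfix
    have hdvd : k ∣ j := by
      have h := twistedGluing_iterate hT (ZMod.val_lt a) y j
      rw [ZMod.natCast_zmod_val, hfix] at h
      have h2 := congrArg Prod.snd h
      simpa [ZMod.natCast_eq_zero_iff] using h2
    obtain ⟨i, rfl⟩ := hdvd
    rw [twistedGluing_iterate_mul hk hT] at hfix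
    exact hfree i (Nat.pos_of_mul_pos_left hj) (Nat.lt_of_mul_lt_mul_left hjkm) y
      (congrArg Prod.fst hfix)
end

section
/- Let f, g : ℝ → ℝ be infinitely differentiable concave functions and r₀ ∈ ℝ with f(r) < g(r) for all r < r₀ and g(r) < f(r) for all r > r₀. Then for every ε > 0 there exist real numbers α < r₀ < β and an infinitely differentiable concave function h : ℝ → ℝ such that h(r) = f(r) for all r ≤ α, h(r) = g(r) for all r ≥ β, and |h(r) − min(f(r), g(r))| ≤ ε for all r ∈ ℝ. -/
open Set Filter Topology

theorem eq_of_hasDerivAt_eq_zero {u u' : ℝ → ℝ} {a x : ℝ} (hu : ∀ y, HasDerivAt u (u' y) y)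
    (h : ∀ y ∈ uIcc a x, u' y = 0) : u x = u a := by
  have := (convex_uIcc a x).norm_image_sub_le_of_norm_hasDerivWithin_le (C := 0)
    (fun y _ => (hu y).hasDerivWithinAt) (fun y hy => by simp [h y hy])
    left_mem_uIcc right_mem_uIcc
  rw [zero_mul] at this
  exact sub_eq_zero.1 (norm_le_zero_iff.1 this)

theorem contDiff_top_of_hasDerivAt {K k : ℝ → ℝ} (hk : ContDiff ℝ (⊤ : ℕ∞) k)
    (hK : ∀ x, HasDerivAt K (k x) x) : ContDiff ℝ (⊤ : ℕ∞) K := by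
  have : deriv K = k := funext fun x => (hK x).deriv
  exact contDiff_infty_iff_deriv.2 ⟨fun x => (hK x).differentiableAt, this ▸ hk⟩

theorem exists_contDiff_primitive {k : ℝ → ℝ} (hk : ContDiff ℝ (⊤ : ℕ∞) k) (a : ℝ) :
    ∃ K : ℝ → ℝ, ContDiff ℝ (⊤ : ℕ∞) K ∧ K a = 0 ∧ ∀ x, HasDerivAt K (k x) x := by
  have hd (x : ℝ) : HasDerivAt (fun x => ∫ t in a..x, k t) (k x) x :=
    hk.continuous.integral_hasStrictDerivAt a x |>.hasDerivAt
  exact ⟨_, contDiff_top_of_hasDerivAt hk hd, by simp, hd⟩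

theorem convexOn_univ_of_hasDerivAt_monotone {u u' : ℝ → ℝ} (hu : ∀ x, HasDerivAt u (u' x) x)
    (h : Monotone u') : ConvexOn ℝ univ u := by
  have : deriv u = u' := funext fun x => (hu x).deriv
  exact Monotone.convexOn_univ_of_deriv (fun x => (hu x).differentiableAt) (this ▸ h)

/-- A smooth convex function which agrees with `max x 0` outside `(-δ, δ)`. -/
theorem exists_contDiff_convexOn_eq_max {δ : ℝ} (hδ : 0 < δ) :
    ∃ ψ : ℝ → ℝ, ContDiff ℝ (⊤ : ℕ∞) ψ ∧ ConvexOn ℝ univ ψ ∧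
      (∀ x ≤ -δ, ψ x = 0) ∧ ∀ x, δ ≤ x → ψ x = x := by
  set θ : ℝ → ℝ := fun x => Real.smoothTransition ((x + δ) / (2 * δ)) with hθ
  have hsymm (x : ℝ) : θ x + θ (-x) = 1 := by
    have hx : (-x + δ) / (2 * δ) = 1 - (x + δ) / (2 * δ) := by field_simp; ring
    have hpos := Real.smoothTransition.pos_denom ((x + δ) / (2 * δ))
    simp only [hθ, hx, Real.smoothTransition, sub_sub_cancel]
    rw [add_comm (expNegInvGlue (1 - _)), ← add_div, div_self hpos.ne']
  obtain ⟨ψ, hψ, hψ0, hψd⟩ := exists_contDiff_primitive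
    (k := θ) (Real.smoothTransition.contDiff.comp (by fun_prop)) (-δ)
  have hleft (x : ℝ) (hx : x ≤ -δ) : ψ x = 0 := by
    rw [← hψ0]
    refine eq_of_hasDerivAt_eq_zero hψd fun y hy => ?_
    rw [uIcc_of_ge hx] at hy
    exact Real.smoothTransition.zero_of_nonpos
      (div_nonpos_of_nonpos_of_nonneg (by linarith [hy.2]) (by linarith))
  have hodd (x : ℝ) : ψ x - ψ (-x) - x = 0 := by
    have hd (y : ℝ) : HasDerivAt (fun x => ψ x - ψ (-x) - x) (θ y - θ (-y) * (-1) - 1) y :=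
      ((hψd y).sub ((hψd (-y)).comp y (hasDerivAt_neg y))).sub (hasDerivAt_id y)
    have := eq_of_hasDerivAt_eq_zero (a := 0) (x := x) hd fun y _ => by linarith [hsymm y]
    simpa using this
  refine ⟨ψ, hψ, convexOn_univ_of_hasDerivAt_monotone hψd fun x y hxy => ?_, hleft,
    fun x hx => ?_⟩
  · exact Real.smoothTransition.monotone (by gcongr)
  · linarith [hodd x, hleft (-x) (by linarith)]

/-- A concave function lies below the tangent of any function it agrees with to the left. -/
theorem ConcaveOn.le_tangent_of_eqOn_Iic {f h : ℝ → ℝ} {a x : ℝ} (hc : ConcaveOn ℝ univ h)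
    (hh : DifferentiableAt ℝ h a) (hf : DifferentiableAt ℝ f a) (heq : ∀ y ≤ a, h y = f y)
    (hx : a ≤ x) : h x ≤ f a + deriv f a * (x - a) := by
  have hu : UniqueDiffWithinAt ℝ (Iic a) a := uniqueDiffWithinAt_Iic a
  have hd : deriv h a = deriv f a := by
    rw [← hh.derivWithin hu, ← hf.derivWithin hu]
    exact derivWithin_congr heq (heq a le_rfl)
  rcases hx.eq_or_lt with rfl | hx
  · simp [heq]
  have := hc.slope_le_deriv (mem_univ a) (mem_univ x) hx hh
  rw [slope_def_field, div_le_iff₀ (sub_pos.2 hx), hd, heq a le_rfl] at this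
  linarith

/-- Cutting off the second derivative of a smooth concave function. -/
theorem exists_concaveOn_eqOn_Iic_affine {f : ℝ → ℝ} (hf : ContDiff ℝ (⊤ : ℕ∞) f)
    (hfc : ConcaveOn ℝ univ f) {α a : ℝ} (hα : α < a) :
    ∃ F : ℝ → ℝ, ContDiff ℝ (⊤ : ℕ∞) F ∧ ConcaveOn ℝ univ F ∧ (∀ x ≤ α, F x = f x) ∧
      (∀ x, f x ≤ F x) ∧ ∃ s, ∀ x, a ≤ x → F x = F a + s * (x - a) := by
  have hf1 : ContDiff ℝ (⊤ : ℕ∞) (deriv f) := (contDiff_infty_iff_deriv.1 hf).2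
  have hf2 : ContDiff ℝ (⊤ : ℕ∞) (deriv (deriv f)) := (contDiff_infty_iff_deriv.1 hf1).2
  have hd0 (x : ℝ) : HasDerivAt f (deriv f x) x :=
    ((contDiff_infty_iff_deriv.1 hf).1 x).hasDerivAt
  have hd1 (x : ℝ) : HasDerivAt (deriv f) (deriv (deriv f) x) x :=
    ((contDiff_infty_iff_deriv.1 hf1).1 x).hasDerivAt
  have hneg (x : ℝ) : deriv (deriv f) x ≤ 0 := by
    have : Antitone (deriv f) := antitoneOn_univ.1
      (hfc.antitoneOn_deriv fun x _ => (hd0 x).differentiableAt)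
    exact this.deriv_nonpos
  set χ : ℝ → ℝ := fun x => Real.smoothTransition ((x - α) / (a - α))
  have hχs : ContDiff ℝ (⊤ : ℕ∞) χ := Real.smoothTransition.contDiff.comp (by fun_prop)
  have hχ0 (x : ℝ) (hx : x ≤ α) : χ x = 0 := Real.smoothTransition.zero_of_nonpos
    (div_nonpos_of_nonpos_of_nonneg (by linarith) (by linarith))
  have hχ1 (x : ℝ) (hx : a ≤ x) : χ x = 1 := Real.smoothTransition.one_of_one_le
    ((one_le_div (by linarith)).2 (by linarith))
  have hχn (x : ℝ) : 0 ≤ χ x := Real.smoothTransition.nonneg _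
  have hχl (x : ℝ) : χ x ≤ 1 := Real.smoothTransition.le_one _
  obtain ⟨E, hE, hEα, hEd⟩ := exists_contDiff_primitive
    (k := fun x => -(χ x * deriv (deriv f) x)) (hχs.mul hf2).neg α
  obtain ⟨D, hD, hDα, hDd⟩ := exists_contDiff_primitive hE α
  have hEmono : Monotone E := monotone_of_hasDerivAt_nonneg hEd fun x =>
    neg_nonneg.2 (mul_nonpos_of_nonneg_of_nonpos (hχn x) (hneg x))
  have hE0 (x : ℝ) (hx : x ≤ α) : E x = 0 := by
    rw [← hEα]
    refine eq_of_hasDerivAt_eq_zero hEd fun y hy => ?_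
    rw [uIcc_of_ge hx] at hy
    simp [hχ0 y hy.2]
  have hD0 (x : ℝ) (hx : x ≤ α) : D x = 0 := by
    rw [← hDα]
    refine eq_of_hasDerivAt_eq_zero hDd fun y hy => ?_
    rw [uIcc_of_ge hx] at hy
    exact hE0 y hy.2
  have hEn (x : ℝ) : 0 ≤ E x := by
    rcases le_total x α with hx | hx
    · exact (hE0 x hx).ge
    · exact hEα ▸ hEmono hx
  have hDn (x : ℝ) : 0 ≤ D x := by
    rcases le_total x α with hx | hx
    · exact (hD0 x hx).ge
    · exact hDα ▸ monotone_of_hasDerivAt_nonneg hDd hEn hx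
  have hFd (x : ℝ) : HasDerivAt (fun x => f x + D x) (deriv f x + E x) x := (hd0 x).add (hDd x)
  have hFd' (x : ℝ) : HasDerivAt (fun x => deriv f x + E x)
      (deriv (deriv f) x + -(χ x * deriv (deriv f) x)) x := (hd1 x).add (hEd x)
  refine ⟨fun x => f x + D x, hf.add hD, ?_, fun x hx => by simp [hD0 x hx],
    fun x => by linarith [hDn x], deriv f a + E a, fun x hx => ?_⟩
  · have := convexOn_univ_of_hasDerivAt_monotone (fun x => (hFd x).neg)
      (monotone_of_hasDerivAt_nonneg (fun x => (hFd' x).neg)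
        fun x => show 0 ≤ -(_ : ℝ) by nlinarith [hχl x, hneg x])
    exact neg_convexOn_iff.1 this
  · have hconst (y : ℝ) (hy : a ≤ y) : deriv f y + E y = deriv f a + E a := by
      refine eq_of_hasDerivAt_eq_zero hFd' fun z hz => ?_
      rw [uIcc_of_le hy] at hz
      rw [hχ1 z hz.1]
      ring
    have := eq_of_hasDerivAt_eq_zero (a := a) (x := x)
      (fun y => (hFd y).sub (((hasDerivAt_id y).sub_const a).const_mul (deriv f a + E a)))
      fun y hy => by
        rw [uIcc_of_le hx] at hy
        rw [hconst y hy.1]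
        ring
    simp only [Pi.sub_apply, id, sub_self, mul_zero, sub_zero] at this
    linarith

theorem ConcaveOn.comp_neg_univ {f : ℝ → ℝ} (hf : ConcaveOn ℝ univ f) :
    ConcaveOn ℝ univ fun x => f (-x) :=
  hf.comp_linearMap (-LinearMap.id : ℝ →ₗ[ℝ] ℝ)

/-- Two smooth concave functions that are affine on overlapping half-lines and cross
transversally in the overlap can be joined to a smooth concave function. -/
theorem exists_concaveOn_glue {F G : ℝ → ℝ} (hF : ContDiff ℝ (⊤ : ℕ∞) F)
    (hG : ContDiff ℝ (⊤ : ℕ∞) G) (hFc : ConcaveOn ℝ univ F) (hGc : ConcaveOn ℝ univ G)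
    {a b s t : ℝ} (hab : a < b) (hFa : ∀ x, a ≤ x → F x = F a + s * (x - a))
    (hGb : ∀ x ≤ b, G x = G b + t * (x - b)) (ha : F a < G a) (hb : G b < F b) :
    ∃ h : ℝ → ℝ, ContDiff ℝ (⊤ : ℕ∞) h ∧ ConcaveOn ℝ univ h ∧
      (∀ x ≤ a, h x = F x) ∧ ∀ x, b ≤ x → h x = G x := by
  have hFb := hFa b hab.le
  have hGa := hGb a hab.le
  have hst : 0 < s - t := by
    by_contra hn
    nlinarith
  obtain ⟨c, hc⟩ : ∃ c, (s - t) * (c - a) = G a - F a :=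
    ⟨a + (G a - F a) / (s - t), by field_simp; ring⟩
  have hac : a < c := by
    by_contra hn
    nlinarith
  have hcb : c < b := by
    by_contra hn
    nlinarith
  obtain ⟨ψ, hψ, hψc, hψl, hψr⟩ := exists_contDiff_convexOn_eq_max
    (δ := min (c - a) (b - c)) (lt_min (by linarith) (by linarith))
  refine ⟨fun x => F x + (G x + (-t * x + (t * b - G b))) + -((s - t) * ψ (x - c)), ?_, ?_,
    fun x hx => ?_, fun x hx => ?_⟩
  · exact (hF.add (hG.add (by fun_prop))).add
      (contDiff_const.mul (hψ.comp (by fun_prop))).neg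
  · have hlin : ConcaveOn ℝ univ fun x : ℝ => -t * x + (t * b - G b) :=
      ⟨convex_univ, fun x _ y _ p q _ _ hpq => by
        simp only [smul_eq_mul]
        linear_combination (t * b - G b) * hpq⟩
    have hψ' : ConvexOn ℝ univ fun x => ψ (x - c) := by
      simpa [Function.comp_def, sub_eq_add_neg] using hψc.translate_left (-c)
    exact (hFc.add (hGc.add hlin)).add (hψ'.smul hst.le).neg
  · have := hψl (x - c) (by linarith [min_le_left (c - a) (b - c)])
    simp only [this, hGb x (by linarith)]
    ring
  · have := hψr (x - c) (by linarith [min_le_right (c - a) (b - c)])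
    simp only [this, hFa x (by linarith)]
    linear_combination hc + hGa

theorem exists_tangent_lt {f : ℝ → ℝ} (hf : ContDiff ℝ (⊤ : ℕ∞) f) {l a y : ℝ} (hl : l < a)
    (hy : f a < y) : ∃ α, l < α ∧ α < a ∧ f α + deriv f α * (a - α) < y := by
  have hf1 : Continuous (deriv f) := (contDiff_infty_iff_deriv.1 hf).2.continuous
  have hf0 := hf.continuous
  have hcont : Continuous fun α => f α + deriv f α * (a - α) := by fun_prop
  have h1 : ∀ᶠ α in 𝓝[<] a, f α + deriv f α * (a - α) < y :=
    (hcont.continuousAt.eventually_lt continuousAt_const (by simpa using hy)).filter_mono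
      nhdsWithin_le_nhds
  obtain ⟨α, h, hα⟩ := (h1.and (Ioo_mem_nhdsLT hl)).exists
  exact ⟨α, hα.1, hα.2, h⟩

/-- A smooth concave function equal to `f` on the left and `g` on the right, with the transition in
an arbitrarily small interval around the crossing. -/
theorem exists_concaveOn_join {f g : ℝ → ℝ} {r₀ : ℝ}
    (hf : ContDiff ℝ (⊤ : ℕ∞) f) (hg : ContDiff ℝ (⊤ : ℕ∞) g)
    (hfc : ConcaveOn ℝ univ f) (hgc : ConcaveOn ℝ univ g)
    (h₁ : ∀ r < r₀, f r < g r) (h₂ : ∀ r, r₀ < r → g r < f r) {δ : ℝ} (hδ : 0 < δ) :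
    ∃ (α β : ℝ) (h : ℝ → ℝ), r₀ - δ < α ∧ α < r₀ ∧ r₀ < β ∧ β < r₀ + δ ∧
      ContDiff ℝ (⊤ : ℕ∞) h ∧ ConcaveOn ℝ univ h ∧
      (∀ r ≤ α, h r = f r) ∧ ∀ r, β ≤ r → h r = g r := by
  obtain ⟨a, ha, ha'⟩ := exists_between (sub_lt_self r₀ hδ)
  obtain ⟨b, hb', hb⟩ := exists_between (lt_add_of_pos_right r₀ hδ)
  obtain ⟨α, hα, hαa, hαt⟩ := exists_tangent_lt hf ha (h₁ a ha')
  set k : ℝ → ℝ := fun x => g (-x) with hk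
  have hks : ContDiff ℝ (⊤ : ℕ∞) k := hg.comp contDiff_neg
  have hkc : ConcaveOn ℝ univ k := hgc.comp_neg_univ
  obtain ⟨β, hβ, hβb, hβt⟩ := exists_tangent_lt hks (neg_lt_neg hb)
    (show k (-b) < f b by simpa [hk] using h₂ b hb')
  obtain ⟨F, hF, hFc, hFl, hFf, s, hFs⟩ := exists_concaveOn_eqOn_Iic_affine hf hfc hαa
  obtain ⟨G, hG, hGc, hGl, hGk, t, hGt⟩ := exists_concaveOn_eqOn_Iic_affine hks hkc hβb
  have hGg (x : ℝ) : g x ≤ G (-x) := by simpa [hk] using hGk (-x)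
  have hFa := hFc.le_tangent_of_eqOn_Iic (hF.differentiable (by simp) α)
    (hf.differentiable (by simp) α) hFl hαa.le
  have hGb := hGc.le_tangent_of_eqOn_Iic (hG.differentiable (by simp) β)
    (hks.differentiable (by simp) β) hGl hβb.le
  obtain ⟨h, hs, hc, hl, hr⟩ := exists_concaveOn_glue hF (hG.comp contDiff_neg) hFc
    hGc.comp_neg_univ (ha'.trans hb') hFs (t := -t)
    (fun x hx => by
      simp only [Function.comp_apply]
      rw [hGt (-x) (by linarith)]
      ring)
    (by simpa using (hFa.trans_lt hαt).trans_le (hGg a))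
    (by simpa using (hGb.trans_lt hβt).trans_le (hFf b))
  refine ⟨α, -β, h, hα, hαa.trans ha', by linarith, by linarith, hs, hc, fun r hr' => ?_,
    fun r hr' => ?_⟩
  · rw [hl r (by linarith), hFl r hr']
  · rw [hr r (by linarith)]
    simpa [hk] using hGl (-r) (by linarith)


/-- Smoothing the minimum of two smooth concave functions crossing at `r₀`: for every
`ε > 0` there are `α < r₀ < β` and a smooth concave `h` equal to `f` for `r ≤ α`, equal
to `g` for `r ≥ β`, and uniformly `ε`-close to `min f g`. -/
theorem stmt15 (f g : ℝ → ℝ) (r₀ : ℝ)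
    (hf : ContDiff ℝ (⊤ : ℕ∞) f) (hg : ContDiff ℝ (⊤ : ℕ∞) g)
    (hfc : ConcaveOn ℝ Set.univ f) (hgc : ConcaveOn ℝ Set.univ g)
    (h₁ : ∀ r < r₀, f r < g r) (h₂ : ∀ r, r₀ < r → g r < f r)
    (ε : ℝ) (hε : 0 < ε) :
    ∃ (α β : ℝ) (h : ℝ → ℝ), α < r₀ ∧ r₀ < β ∧
      ContDiff ℝ (⊤ : ℕ∞) h ∧ ConcaveOn ℝ Set.univ h ∧
      (∀ r ≤ α, h r = f r) ∧
      (∀ r, β ≤ r → h r = g r) ∧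
      (∀ r, |h r - min (f r) (g r)| ≤ ε) := by
  have hfc0 := hf.continuous
  have hgc0 := hg.continuous
  have hfd : Continuous (deriv f) := (contDiff_infty_iff_deriv.1 hf).2.continuous
  have hfg : f r₀ = g r₀ := by
    apply le_antisymm
    · exact le_of_tendsto_of_tendsto (hfc0.tendsto' r₀ _ rfl |>.mono_left nhdsWithin_le_nhds)
        (hgc0.tendsto' r₀ _ rfl |>.mono_left nhdsWithin_le_nhds)
        (eventually_mem_nhdsWithin.mono fun r hr => (h₁ r hr).le : ∀ᶠ r in 𝓝[<] r₀, f r ≤ g r)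
    · exact le_of_tendsto_of_tendsto (hgc0.tendsto' r₀ _ rfl |>.mono_left nhdsWithin_le_nhds)
        (hfc0.tendsto' r₀ _ rfl |>.mono_left nhdsWithin_le_nhds)
        (eventually_mem_nhdsWithin.mono fun r hr => (h₂ r hr).le : ∀ᶠ r in 𝓝[>] r₀, g r ≤ f r)
  set K := |deriv f r₀| + 1 with hK
  have hKpos : 0 < K := by positivity
  have hev : ∀ᶠ r in 𝓝 r₀, |f r - f r₀| < ε / 3 ∧ |g r - f r₀| < ε / 3 ∧ |deriv f r| < K := by
    refine (ContinuousAt.eventually_lt (by fun_prop) continuousAt_const (by simpa)).and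
      ((ContinuousAt.eventually_lt (by fun_prop) continuousAt_const (by simpa [hfg])).and
        (ContinuousAt.eventually_lt (by fun_prop) continuousAt_const (by simp [hK])))
  obtain ⟨δ₀, hδ₀, hball⟩ := Metric.eventually_nhds_iff.1 hev
  obtain ⟨α, β, h, hδα, hα, hβ, hβδ, hs, hc, hl, hr⟩ := exists_concaveOn_join hf hg hfc hgc h₁ h₂
    (δ := min δ₀ (ε / 3 / (2 * K))) (by positivity)
  have hm1 := min_le_left δ₀ (ε / 3 / (2 * K))
  have hm2 := min_le_right δ₀ (ε / 3 / (2 * K))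
  rw [le_div_iff₀ (by positivity)] at hm2
  refine ⟨α, β, h, hα, hβ, hs, hc, hl, hr, fun r => ?_⟩
  rcases le_total r α with hrα | hrα
  · rw [hl r hrα, min_eq_left (h₁ r (by linarith)).le]
    simpa using hε.le
  rcases le_total β r with hrβ | hrβ
  · rw [hr r hrβ, min_eq_right (h₂ r (by linarith)).le]
    simpa using hε.le
  have near (x : ℝ) (hx : x ∈ Icc α β) :=
    hball (y := x) (by rw [Real.dist_eq, abs_lt]; constructor <;> linarith [hx.1, hx.2])
  have hαβ : α ≤ β := (hα.trans hβ).le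
  obtain ⟨hfα, -, hdα⟩ := near α ⟨le_rfl, hαβ⟩
  obtain ⟨-, hgβ, -⟩ := near β ⟨hαβ, le_rfl⟩
  obtain ⟨hfr, hgr, -⟩ := near r ⟨hrα, hrβ⟩
  rw [abs_lt] at hfα hgβ hfr hgr
  have hupper := hc.le_tangent_of_eqOn_Iic (hs.differentiable (by simp) α)
    (hf.differentiable (by simp) α) hl hrα
  have hslope : deriv f α * (r - α) ≤ ε / 3 :=
    calc deriv f α * (r - α) ≤ K * (r - α) :=
          mul_le_mul_of_nonneg_right ((le_abs_self _).trans hdα.le) (sub_nonneg.2 hrα)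
      _ ≤ K * (2 * min δ₀ (ε / 3 / (2 * K))) := by gcongr; linarith
      _ ≤ ε / 3 := by linarith
  have hlower : f r₀ - ε / 3 ≤ h r :=
    (le_min (by rw [hl α le_rfl]; linarith) (by rw [hr β le_rfl]; linarith)).trans
      (hc.min_le_of_mem_Icc (mem_univ α) (mem_univ β) ⟨hrα, hrβ⟩)
  have hmin : f r₀ - ε / 3 ≤ min (f r) (g r) := le_min (by linarith) (by linarith)
  have hmin' := min_le_left (f r) (g r)
  rw [abs_le]
  constructor <;> linarith
end

section
/- For every real x ∈ [0, π]: 0 ≤ x − 2·sin(x/2) ≤ 10·(1 − cos x). Equivalently, setting ε = 1 − cos x, one has √(2ε) = 2·sin(x/2) and |x − √(2ε)| ≤ 10·ε. -/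
theorem sub_sin_le_sin_sq {t : ℝ} (h0 : 0 ≤ t) (h1 : t ≤ Real.pi / 2) :
    t - Real.sin t ≤ 10 * Real.sin t ^ 2 := by
  have hs : t / 2 ≤ Real.sin t := by
    refine le_trans ?_ (Real.mul_le_sin h0 h1)
    rw [div_mul_eq_mul_div, div_le_div_iff₀ two_pos Real.pi_pos]
    nlinarith [Real.pi_le_four]
  rcases h0.eq_or_lt with rfl | hpos
  · simp
  rcases le_total t 1 with h | h
  · have hc := Real.sin_gt_sub_cube hpos
    have : t ^ 3 ≤ t ^ 2 := pow_le_pow_of_le_one h0 h (by norm_num)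
    nlinarith
  · nlinarith [Real.pi_le_four]

/-- For `x ∈ [0, π]`: `0 ≤ x - 2·sin(x/2) ≤ 10·(1 - cos x)`; equivalently, with
`ε = 1 - cos x`, `√(2ε) = 2·sin(x/2)` and `|x - √(2ε)| ≤ 10·ε`. -/
theorem stmt16 (x : ℝ) (hx : x ∈ Set.Icc 0 Real.pi) :
    (0 ≤ x - 2 * Real.sin (x / 2) ∧
      x - 2 * Real.sin (x / 2) ≤ 10 * (1 - Real.cos x)) ∧
    (Real.sqrt (2 * (1 - Real.cos x)) = 2 * Real.sin (x / 2) ∧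
      |x - Real.sqrt (2 * (1 - Real.cos x))| ≤ 10 * (1 - Real.cos x)) := by
  obtain ⟨h0, hpi⟩ := hx
  have hcos : 1 - Real.cos x = 2 * Real.sin (x / 2) ^ 2 := by
    have h := Real.cos_two_mul (x / 2)
    rw [mul_div_cancel₀ x two_ne_zero] at h
    linarith [Real.sin_sq_add_cos_sq (x / 2)]
  have hsin : 0 ≤ Real.sin (x / 2) :=
    Real.sin_nonneg_of_nonneg_of_le_pi (by linarith) (by linarith)
  have hlower : 0 ≤ x - 2 * Real.sin (x / 2) := by
    linarith [Real.sin_le (show 0 ≤ x / 2 by linarith)]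
  have hupper : x - 2 * Real.sin (x / 2) ≤ 10 * (1 - Real.cos x) := by
    linarith [sub_sin_le_sin_sq (show 0 ≤ x / 2 by linarith) (by linarith)]
  have hsqrt : Real.sqrt (2 * (1 - Real.cos x)) = 2 * Real.sin (x / 2) := by
    rw [hcos, show 2 * (2 * Real.sin (x / 2) ^ 2) = (2 * Real.sin (x / 2)) ^ 2 by ring]
    exact Real.sqrt_sq (by linarith)
  exact ⟨⟨hlower, hupper⟩, hsqrt, by rwa [hsqrt, abs_of_nonneg hlower]⟩
end

section
/- For every R > 0 and every ε ∈ (0, 1/2) there exists a unique c ∈ (0, 2πR] such that R·sin((r − c)/R) ≤ (1 − ε)·r for all r > 0 and R·sin((r − c)/R) = (1 − ε)·r for some r > 0. Moreover this unique value is c = R·(tan x − x) where x = arccos(1 − ε). -/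
open Real in
/-- On `[0, π]` the sine lies below each of its tangent lines. -/
lemma sin_le_tangent {x t : ℝ} (hx : x ∈ Set.Icc 0 π) (ht : t ∈ Set.Icc 0 π) :
    sin t ≤ sin x + cos x * (t - x) := by
  have hc : ConcaveOn ℝ (Set.Icc 0 π) sin := strictConcaveOn_sin_Icc.concaveOn
  rcases lt_trichotomy t x with h | h | h
  · have := hc.le_slope_of_hasDerivAt ht hx h (hasDerivAt_sin x)
    rw [slope_def_field, le_div_iff₀ (by linarith)] at this
    linarith
  · simp [h]
  · have := hc.slope_le_of_hasDerivAt hx ht h (hasDerivAt_sin x)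
    rw [slope_def_field, div_le_iff₀ (by linarith)] at this
    linarith

open Real in
/-- If `cos x ≥ 1 / 2`, the line of slope `cos x` tangent to the sine at `x` dominates the sine to
the right of its root. -/
lemma sin_sub_le_cos_mul {x : ℝ} (hx : x ∈ Set.Ioo 0 π) (hcos : 1 / 2 ≤ cos x) {s : ℝ}
    (hs : 0 < s) (hd : tan x - x ∈ Set.Ioc 0 π) :
    sin (s - (tan x - x)) ≤ cos x * s := by
  have htan : cos x * tan x = sin x := by
    rw [mul_comm]; exact tan_mul_cos (by linarith)
  have hpos : 0 < cos x * s := by positivity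
  obtain ⟨hd0, hdpi⟩ := hd
  set t := s - (tan x - x) with ht
  rcases le_total t 0 with h0 | h0
  · exact (sin_nonpos_of_nonpos_of_neg_pi_le h0 (by linarith)).trans hpos.le
  rcases le_total t π with h1 | h1
  · have h2 := sin_le_tangent (Set.Ioo_subset_Icc_self hx) ⟨h0, h1⟩
    have h3 : cos x * s = sin x + cos x * (t - x) := by rw [← htan, ht]; ring
    linarith
  · have := sin_le_one t
    have := pi_gt_three
    nlinarith

open Real in
/-- A shift `d ∈ (0, 2π]` for which `s ↦ sin (s - d)` stays below `s ↦ cos x * s` on the positive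
half-line and touches it there is `tan x - x`. -/
lemma eq_tan_sub_of_sin_sub_le_of_eq {x d : ℝ} (hx : x ∈ Set.Ioo 0 π) (hcos : 1 / 2 ≤ cos x)
    (hd₀ : tan x - x ∈ Set.Ioc 0 π) (hd : d ∈ Set.Ioc 0 (2 * π))
    (hle : ∀ s, 0 < s → sin (s - d) ≤ cos x * s)
    (heq : ∃ s, 0 < s ∧ sin (s - d) = cos x * s) : d = tan x - x := by
  have hc : 0 < cos x := by linarith
  have htan : cos x * tan x = sin x := by rw [mul_comm]; exact tan_mul_cos hc.ne'
  obtain ⟨hd0, hd2⟩ := hd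
  apply le_antisymm
  · by_contra! hlt
    obtain ⟨s, hs, hseq⟩ := heq
    have hpos : 0 < cos x * s := by positivity
    rcases lt_or_ge (-π) (s - d) with h | h
    · have ht : 0 < s - d := by
        by_contra! h0
        linarith [sin_nonpos_of_nonpos_of_neg_pi_le h0 h.le]
      have h1 := sin_sub_le_cos_mul hx hcos (s := s - d + (tan x - x))
        (by linarith [hd₀.1]) hd₀
      rw [add_sub_cancel_right, hseq] at h1
      have := le_of_mul_le_mul_left h1 hc
      linarith
    · have hδ : 2 * π - d ∈ Set.Icc 0 π := ⟨by linarith, by linarith⟩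
      have hu : s + (2 * π - d) ∈ Set.Icc 0 π := ⟨by linarith [hδ.1], by linarith⟩
      have hmid := strictConcaveOn_sin_Icc.2 hδ hu (by linarith)
        (show (0 : ℝ) < 1 / 2 by norm_num) (show (0 : ℝ) < 1 / 2 by norm_num) (by norm_num)
      have hδs := sin_nonneg_of_mem_Icc hδ
      have h1 := hle (s / 2) (by linarith)
      have h2 : sin (s + (2 * π - d)) = sin (s - d) := by
        rw [← sin_add_two_pi (s - d)]; ring_nf
      have h3 : sin ((1 / 2 : ℝ) • (2 * π - d) + (1 / 2 : ℝ) • (s + (2 * π - d)))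
          = sin (s / 2 - d) := by
        rw [← sin_add_two_pi (s / 2 - d)]; simp only [smul_eq_mul]; ring_nf
      rw [h3, h2, hseq] at hmid
      simp only [smul_eq_mul] at hmid
      linarith
  · have h1 := hle (x + d) (by linarith [hx.1])
    rw [add_sub_cancel_right, ← htan] at h1
    have := le_of_mul_le_mul_left h1 hc
    linarith

/-- For `R > 0` and `ε ∈ (0, 1/2)` there is a unique `c ∈ (0, 2πR]` such that
`R·sin((r - c)/R) ≤ (1 - ε)·r` for all `r > 0` with equality for some `r > 0`;
moreover this unique value is `c = R·(tan x - x)` where `x = arccos (1 - ε)`. -/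
theorem stmt18 (R ε : ℝ) (hR : 0 < R) (hε : ε ∈ Set.Ioo 0 (1 / 2 : ℝ)) :
    (∃! c : ℝ, c ∈ Set.Ioc 0 (2 * Real.pi * R) ∧
      (∀ r : ℝ, 0 < r → R * Real.sin ((r - c) / R) ≤ (1 - ε) * r) ∧
      (∃ r : ℝ, 0 < r ∧ R * Real.sin ((r - c) / R) = (1 - ε) * r)) ∧
    (R * (Real.tan (Real.arccos (1 - ε)) - Real.arccos (1 - ε)) ∈
        Set.Ioc 0 (2 * Real.pi * R) ∧
      (∀ r : ℝ, 0 < r →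
        R * Real.sin ((r - R * (Real.tan (Real.arccos (1 - ε)) - Real.arccos (1 - ε))) / R)
          ≤ (1 - ε) * r) ∧
      (∃ r : ℝ, 0 < r ∧
        R * Real.sin ((r - R * (Real.tan (Real.arccos (1 - ε)) - Real.arccos (1 - ε))) / R)
          = (1 - ε) * r)) := by
  obtain ⟨hε0, hε1⟩ := hε
  set x := Real.arccos (1 - ε)
  have hcosx : Real.cos x = 1 - ε := Real.cos_arccos (by linarith) (by linarith)
  rw [← hcosx]
  have hcos : 1 / 2 ≤ Real.cos x := by linarith
  have hx0 : 0 < x := Real.arccos_pos.2 (by linarith)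
  have hx2 : x < Real.pi / 2 := Real.arccos_lt_pi_div_two.2 (by linarith)
  have hx : x ∈ Set.Ioo 0 Real.pi := ⟨hx0, by linarith⟩
  have htan : Real.tan x ≤ 2 := by
    rw [Real.tan_eq_sin_div_cos, div_le_iff₀ (by linarith)]
    linarith [Real.sin_le_one x]
  have hd₀ : Real.tan x - x ∈ Set.Ioc 0 Real.pi :=
    ⟨by linarith [Real.lt_tan hx0 hx2], by linarith [Real.pi_gt_three]⟩
  have hmem : R * (Real.tan x - x) ∈ Set.Ioc 0 (2 * Real.pi * R) :=
    ⟨mul_pos hR hd₀.1, by nlinarith [hd₀.2, Real.pi_pos]⟩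
  have hle : ∀ r : ℝ, 0 < r →
      R * Real.sin ((r - R * (Real.tan x - x)) / R) ≤ Real.cos x * r := by
    intro r hr
    have h := sin_sub_le_cos_mul hx hcos (div_pos hr hR) hd₀
    rw [sub_div, mul_div_cancel_left₀ _ hR.ne']
    calc _ ≤ R * (Real.cos x * (r / R)) := by gcongr
      _ = _ := by field_simp
  have heq : ∃ r : ℝ, 0 < r ∧
      R * Real.sin ((r - R * (Real.tan x - x)) / R) = Real.cos x * r := by
    refine ⟨R * Real.tan x, mul_pos hR (by linarith [hd₀.1]), ?_⟩
    have h : (R * Real.tan x - R * (Real.tan x - x)) / R = x := by field_simp; ring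
    rw [h, ← Real.tan_mul_cos (x := x) (by linarith)]
    ring
  refine ⟨⟨_, ⟨hmem, hle, heq⟩, ?_⟩, hmem, hle, heq⟩
  rintro c ⟨⟨hc0, hc2⟩, hcle, r, hr, hceq⟩
  have h := eq_tan_sub_of_sin_sub_le_of_eq (d := c / R) hx hcos hd₀
    ⟨div_pos hc0 hR, (div_le_iff₀ hR).2 hc2⟩
    (fun s hs => by
      have h := hcle (R * s) (mul_pos hR hs)
      rw [sub_div, mul_div_cancel_left₀ _ hR.ne', mul_left_comm] at h
      exact le_of_mul_le_mul_left h hR)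
    ⟨r / R, div_pos hr hR, by
      rw [← sub_div, ← mul_div_assoc, ← hceq, mul_div_cancel_left₀ _ hR.ne']⟩
  rw [← h, mul_div_cancel₀ _ hR.ne']
end
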